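/- arXiv:2402.17841 — 4 statements merged into one kernel-verified Lean document; each statement's English description precedes it below -/
import Mathlib

section
/- Let M and N be matroids on the same finite ground set E such that the identity map is a rank-preserving weak map from M to N. Then the number of connected components of M is at most the number of connected components of N, i.e., c(M) ≤ c(N). -/
open Matroid Set

/-- The rank of the set `X` in the matroid `M` (the maximum size of an independent
subset of `X`). -/
noncomputable def rkOf {α : Type*} (M : Matroid α) (X : Set α) : ℕ :=
  sSup (Set.ncard '' {I | M.Indep I ∧ I ⊆ X})

/-- `C` is a circuit of `M`: a minimal dependent set. -/
def IsCircuitOf {α : Type*} (M : Matroid α) (C : Set α) : Prop :=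
  M.Dep C ∧ ∀ D, D ⊂ C → M.Indep D

/-- The connectivity relation on the ground set of `M`: `e` and `f` are related iff
`e = f` or some circuit of `M` contains both. -/
def CircRel {α : Type*} (M : Matroid α) (e f : α) : Prop :=
  e = f ∨ ∃ C, IsCircuitOf M C ∧ e ∈ C ∧ f ∈ C

/-- The number of connected components of `M`: the number of equivalence classes of the
connectivity relation on the ground set of `M`. -/
noncomputable def numComponents {α : Type*} (M : Matroid α) : ℕ :=
  ({S : Set α | ∃ e ∈ M.E, S = {f ∈ M.E | CircRel M e f}}).ncard

theorem isCircuitOf_iff {α : Type*} (M : Matroid α) (C : Set α) :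
    IsCircuitOf M C ↔ M.IsCircuit C := by
  rw [isCircuit_iff_forall_ssubset]; rfl

theorem circ_trans_aux {α : Type*} (M : Matroid α) (hfin : M.E.Finite) (e g : α) (n : ℕ) :
    ∀ C₁ C₂ : Set α, M.IsCircuit C₁ → M.IsCircuit C₂ → e ∈ C₁ → g ∈ C₂ →
      (C₁ ∩ C₂).Nonempty → (C₁ ∪ C₂).ncard ≤ n → ∃ C, M.IsCircuit C ∧ e ∈ C ∧ g ∈ C := by
  induction n with
  | zero =>
    intro C₁ C₂ h₁ h₂ he hg hne hn
    have hf : (C₁ ∪ C₂).Finite :=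
      hfin.subset (union_subset h₁.subset_ground h₂.subset_ground)
    have : C₁ ∪ C₂ = ∅ := (ncard_eq_zero hf).1 (by omega)
    have h : e ∈ C₁ ∪ C₂ := Or.inl he
    rw [this] at h
    exact h.elim
  | succ n ih =>
    intro C₁ C₂ h₁ h₂ he hg hne hn
    have hf : (C₁ ∪ C₂).Finite :=
      hfin.subset (union_subset h₁.subset_ground h₂.subset_ground)
    by_contra hcon
    have hno : ∀ C, M.IsCircuit C → e ∈ C → g ∉ C := fun C hC h h' => hcon ⟨C, hC, h, h'⟩
    obtain ⟨f, hf1, hf2⟩ := hne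
    have he2 : e ∉ C₂ := fun h => hno C₂ h₂ h hg
    obtain ⟨C₃, hC₃s, hC₃, he3⟩ := h₁.strong_elimination h₂ hf1 hf2 he he2
    have hns : ¬ C₃ ⊆ C₁ := by
      intro hs
      have := hC₃.eq_of_subset_isCircuit h₁ hs
      subst this
      exact (hC₃s hf1).2 rfl
    obtain ⟨x, hx3, hx1⟩ := not_subset.1 hns
    have hx2 : x ∈ C₂ := (hC₃s hx3).1.resolve_left hx1
    obtain ⟨C₄, hC₄s, hC₄, hg4⟩ := h₂.strong_elimination hC₃ hx2 hx3 hg (hno C₃ hC₃ he3)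
    have hns4 : ¬ C₄ ⊆ C₂ := by
      intro hs
      have := hC₄.eq_of_subset_isCircuit h₂ hs
      subst this
      exact (hC₄s hx2).2 rfl
    obtain ⟨y, hy4, hy2⟩ := not_subset.1 hns4
    have hy3 : y ∈ C₃ := (hC₄s hy4).1.resolve_left hy2
    have hy1 : y ∈ C₁ := (hC₃s hy3).1.resolve_right hy2
    refine hcon (ih C₁ C₄ h₁ hC₄ he hg4 ⟨y, hy1, hy4⟩ ?_)
    have hss : C₁ ∪ C₄ ⊂ C₁ ∪ C₂ := by
      refine (ssubset_iff_of_subset ?_).2 ⟨x, Or.inr hx2, ?_⟩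
      · rintro z (hz | hz)
        · exact Or.inl hz
        · rcases (hC₄s hz).1 with h | h
          · exact Or.inr h
          · exact (hC₃s h).1
      · rintro (h | h)
        · exact hx1 h
        · exact (hC₄s h).2 rfl
    have := ncard_lt_ncard hss hf
    omega

theorem circRel_symm {α : Type*} {M : Matroid α} {e f : α} (h : CircRel M e f) :
    CircRel M f e := by
  rcases h with rfl | ⟨C, hC, h1, h2⟩
  · exact Or.inl rfl
  · exact Or.inr ⟨C, hC, h2, h1⟩

theorem circRel_trans {α : Type*} {M : Matroid α} (hfin : M.E.Finite) {e f g : α}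
    (h : CircRel M e f) (h' : CircRel M f g) : CircRel M e g := by
  rcases h with rfl | ⟨C, hC, h1, h2⟩
  · exact h'
  rcases h' with rfl | ⟨D, hD, h3, h4⟩
  · exact Or.inr ⟨C, hC, h1, h2⟩
  rw [isCircuitOf_iff] at hC hD
  obtain ⟨K, hK, h⟩ := circ_trans_aux M hfin e g _ C D hC hD h1 h4 ⟨f, h2, h3⟩ le_rfl
  exact Or.inr ⟨K, (isCircuitOf_iff M K).2 hK, h⟩

theorem circRel_weak {α : Type*} (M N : Matroid α) (E : Set α)
    (hME : M.E = E) (hNE : N.E = E) (hfin : E.Finite)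
    (hweak : ∀ I : Set α, N.Indep I → M.Indep I) (hrank : rkOf M E = rkOf N E) {e f : α}
    (h : CircRel N e f) : CircRel M e f := by
  rcases h with rfl | ⟨C, hC, h1, h2⟩
  · exact Or.inl rfl
  by_contra hcon
  rw [isCircuitOf_iff] at hC
  have hMfin : M.E.Finite := hME ▸ hfin
  have hCE : C ⊆ N.E := hC.subset_ground
  let X : Set α := {g ∈ N.E | CircRel M e g}
  have hXE : X ⊆ N.E := fun g hg => hg.1
  have heX : e ∈ X := ⟨hCE h1, Or.inl rfl⟩
  have hfX : f ∉ X := fun h => hcon h.2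
  have hi1 : N.Indep (C ∩ X) := hC.ssubset_indep
    ((ssubset_iff_of_subset inter_subset_left).2 ⟨f, h2, fun h => hfX h.2⟩)
  have hi2 : N.Indep (C \ X) := hC.ssubset_indep
    ((ssubset_iff_of_subset sdiff_subset).2 ⟨e, h1, fun h => h.2 heX⟩)
  obtain ⟨I, hI, hCI⟩ := hi1.subset_isBasis_of_subset (X := X) inter_subset_right hXE
  obtain ⟨J, hJ, hCJ⟩ := hi2.subset_isBasis_of_subset (X := N.E \ X)
    (sdiff_subset_sdiff_left hCE) sdiff_subset
  have hIJE : I ∪ J ⊆ E := by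
    rw [← hNE]; exact union_subset hI.indep.subset_ground hJ.indep.subset_ground
  have hIJ : M.Indep (I ∪ J) := by
    by_contra hni
    have hdep : M.Dep (I ∪ J) := ⟨hni, by rw [hME]; exact hIJE⟩
    obtain ⟨D, hDs, hD⟩ := hdep.exists_isCircuit_subset
    by_cases hm : (D ∩ X).Nonempty
    · obtain ⟨x, hxD, hxX⟩ := hm
      have hDI : D ⊆ I := by
        intro y hy
        rcases hDs hy with h | h
        · exact h
        · exact ((hJ.subset h).2 ⟨(hJ.subset h).1, circRel_trans hMfin hxX.2
            (Or.inr ⟨D, (isCircuitOf_iff M D).2 hD, hxD, hy⟩)⟩).elim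
      exact hD.not_indep ((hweak I hI.indep).subset hDI)
    · have hDJ : D ⊆ J := by
        intro y hy
        rcases hDs hy with h | h
        · exact (hm ⟨y, hy, hI.subset h⟩).elim
        · exact h
      exact hD.not_indep ((hweak J hJ.indep).subset hDJ)
  have hsp : N.Spanning (I ∪ J) := by
    rw [spanning_iff_closure_eq (by rw [hNE]; exact hIJE),
      closure_union_congr_left hI.closure_eq_closure,
      closure_union_congr_right hJ.closure_eq_closure, union_sdiff_cancel hXE, closure_ground]
  obtain ⟨B, hB, hBs⟩ := hsp.exists_isBase_subset
  have hbd : BddAbove (Set.ncard '' {I | M.Indep I ∧ I ⊆ E}) := by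
    refine ⟨E.ncard, ?_⟩
    rintro _ ⟨K, hK, rfl⟩
    exact ncard_le_ncard hK.2 hfin
  have hle1 : (I ∪ J).ncard ≤ rkOf M E := le_csSup hbd ⟨_, ⟨hIJ, hIJE⟩, rfl⟩
  have hle2 : rkOf N E ≤ B.ncard := by
    refine csSup_le ⟨_, ∅, ⟨N.empty_indep, empty_subset _⟩, rfl⟩ ?_
    rintro _ ⟨K, hK, rfl⟩
    obtain ⟨B', hB', hKB⟩ := hK.1.exists_isBase_superset
    rw [hB.ncard_eq_ncard_of_isBase hB']
    exact ncard_le_ncard hKB (hfin.subset (hNE ▸ hB'.subset_ground))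
  have hBe : B = I ∪ J := eq_of_subset_of_ncard_le hBs (by omega) (hfin.subset hIJE)
  refine hC.not_indep (hB.indep.subset ?_)
  rw [hBe]
  intro y hy
  by_cases hyX : y ∈ X
  · exact Or.inl (hCI ⟨hy, hyX⟩)
  · exact Or.inr (hCJ ⟨hy, hyX⟩)

/-- If the identity is a rank-preserving weak map from `M` to `N`
(matroids on the same finite ground set `E`), then `c(M) ≤ c(N)`. -/
theorem weak_map_components_le {α : Type*} (M N : Matroid α) (E : Set α)
    (hME : M.E = E) (hNE : N.E = E) (hfin : E.Finite)
    (hweak : ∀ I : Set α, N.Indep I → M.Indep I) (hrank : rkOf M E = rkOf N E) :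
    numComponents M ≤ numComponents N := by
  classical
  have hMfin : M.E.Finite := hME ▸ hfin
  have hcl : ∀ e f, CircRel M e f →
      {g ∈ M.E | CircRel M e g} = {g ∈ M.E | CircRel M f g} := by
    intro e f h
    ext g
    exact ⟨fun hg => ⟨hg.1, circRel_trans hMfin (circRel_symm h) hg.2⟩,
      fun hg => ⟨hg.1, circRel_trans hMfin h hg.2⟩⟩
  have hTfin : ({S : Set α | ∃ e ∈ N.E, S = {f ∈ N.E | CircRel N e f}}).Finite := by
    refine (hfin.finite_subsets).subset ?_
    rintro S ⟨e, he, rfl⟩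
    exact fun x hx => hNE ▸ hx.1
  let F : Set α → Set α := fun S =>
    {g ∈ M.E | ∃ x ∈ S, CircRel M x g}
  have hsub : {S : Set α | ∃ e ∈ M.E, S = {f ∈ M.E | CircRel M e f}} ⊆
      F '' {S : Set α | ∃ e ∈ N.E, S = {f ∈ N.E | CircRel N e f}} := by
    rintro S ⟨e, he, rfl⟩
    have heN : e ∈ N.E := by rw [hNE, ← hME]; exact he
    refine ⟨_, ⟨e, heN, rfl⟩, ?_⟩
    ext g
    constructor
    · rintro ⟨hg, x, hx, hxg⟩
      exact ⟨hg, circRel_trans hMfin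
        (circRel_weak M N E hME hNE hfin hweak hrank hx.2) hxg⟩
    · rintro ⟨hg, h⟩
      exact ⟨hg, e, ⟨heN, Or.inl rfl⟩, h⟩
  exact (ncard_le_ncard hsub (hTfin.image F)).trans (ncard_image_le hTfin)
end

section
/- Let E be a densely totally ordered set and let X and Y be finite subsets of E with |X| ≥ 2, |Y| ≥ 2, and X ∩ Y = {z}. Then X and Y are non-crossing subsets of E if and only if (i) for all x ∈ X and y ∈ Y, x ≤_x z and z ≤_x y; or (ii) for all x ∈ X and y ∈ Y, y ≤_y z and z ≤_y x. -/
/-- The cyclic order `a ≤_w b` induced by the linear order on `E` and the element `w`. -/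
def CycLE {E : Type*} [LinearOrder E] (w a b : E) : Prop :=
  (w ≤ a ∧ w ≤ b ∧ a ≤ b) ∨ (a < w ∧ b < w ∧ a ≤ b) ∨ (w ≤ a ∧ b < w)

/-- The strict cyclic order `a <_w b`. -/
def CycLT {E : Type*} [LinearOrder E] (w a b : E) : Prop := CycLE w a b ∧ a ≠ b

/-- `W` and `Z` are crossing subsets of `E`: there exist `w, y ∈ W` and `x, z ∈ Z` with
`w <_w x <_w y <_w z`. -/
def Crossing {E : Type*} [LinearOrder E] (W Z : Set E) : Prop :=
  ∃ w ∈ W, ∃ y ∈ W, ∃ x ∈ Z, ∃ z ∈ Z,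
    CycLT w w x ∧ CycLT w x y ∧ CycLT w y z


theorem cyc_aux1 {E : Type*} [LinearOrder E] (z x1 y1 x2 y2 : E)
    (h1 : ¬ (CycLE x1 x1 z ∧ CycLE x1 z y1)) (h2 : ¬ (CycLE y2 y2 z ∧ CycLE y2 z x2))
    (h11 : x1 = y1 → x1 = z) (h12 : x1 = y2 → x1 = z)
    (h21 : x2 = y1 → x2 = z) (h22 : x2 = y2 → x2 = z) :
    (CycLT z z y2 ∧ CycLT z y2 x2 ∧ CycLT z x2 y1) ∨
    (CycLT x1 x1 y1 ∧ CycLT x1 y1 x2 ∧ CycLT x1 x2 z) := by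
  unfold CycLT CycLE at *
  grind (splits := 60)

theorem cyc_aux2 {E : Type*} [LinearOrder E] (z w x y v : E)
    (h1 : CycLE w w z ∧ CycLE w z x) (h2 : CycLE w w z ∧ CycLE w z v)
    (h3 : CycLE y y z ∧ CycLE y z x) (h4 : CycLE y y z ∧ CycLE y z v)
    (c1 : CycLT w w x) (c2 : CycLT w x y) (c3 : CycLT w y v) : False := by
  unfold CycLT CycLE at *
  grind (splits := 60)

theorem cyc_aux3 {E : Type*} [LinearOrder E] (z w x y v : E)
    (h1 : CycLE x x z ∧ CycLE x z w) (h2 : CycLE v v z ∧ CycLE v z w)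
    (h3 : CycLE x x z ∧ CycLE x z y) (h4 : CycLE v v z ∧ CycLE v z y)
    (c1 : CycLT w w x) (c2 : CycLT w x y) (c3 : CycLT w y v) : False := by
  unfold CycLT CycLE at *
  grind (splits := 60)

/-- Let `E` be a densely totally ordered set and `X, Y` finite subsets
with `|X| ≥ 2`, `|Y| ≥ 2` and `X ∩ Y = {z}`. Then `X` and `Y` are non-crossing iff
(i) for all `x ∈ X` and `y ∈ Y`, `x ≤_x z ≤_x y`, or (ii) for all `x ∈ X` and `y ∈ Y`,
`y ≤_y z ≤_y x`. -/
theorem noncrossing_iff {E : Type*} [LinearOrder E] [DenselyOrdered E]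
    (X Y : Set E) (hXfin : X.Finite) (hYfin : Y.Finite)
    (hX2 : 2 ≤ X.ncard) (hY2 : 2 ≤ Y.ncard) (z : E) (hXY : X ∩ Y = {z}) :
    ¬ Crossing X Y ↔
      ((∀ x ∈ X, ∀ y ∈ Y, CycLE x x z ∧ CycLE x z y) ∨
        (∀ x ∈ X, ∀ y ∈ Y, CycLE y y z ∧ CycLE y z x)) := by
  have hz : z ∈ X ∩ Y := by rw [hXY]; rfl
  have hne : ∀ x ∈ X, ∀ y ∈ Y, x = y → x = z := by
    intro x hx y hy e
    have : x ∈ X ∩ Y := ⟨hx, e ▸ hy⟩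
    rw [hXY] at this
    exact this
  constructor
  · intro hc
    by_contra hcon
    rw [not_or] at hcon
    obtain ⟨ha, hb⟩ := hcon
    simp only [not_forall] at ha hb
    obtain ⟨x1, hx1, y1, hy1, h1⟩ := ha
    obtain ⟨x2, hx2, y2, hy2, h2⟩ := hb
    rcases cyc_aux1 z x1 y1 x2 y2 h1 h2 (hne _ hx1 _ hy1) (hne _ hx1 _ hy2)
      (hne _ hx2 _ hy1) (hne _ hx2 _ hy2) with h | h
    · exact hc ⟨z, hz.1, x2, hx2, y2, hy2, y1, hy1, h⟩
    · exact hc ⟨x1, hx1, x2, hx2, y1, hy1, z, hz.2, h⟩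
  · rintro (h | h) ⟨w, hw, y, hy, x, hx, v, hv, c1, c2, c3⟩
    · exact cyc_aux2 z w x y v (h _ hw _ hx) (h _ hw _ hv) (h _ hy _ hx) (h _ hy _ hv) c1 c2 c3
    · exact cyc_aux3 z w x y v (h _ hw _ hx) (h _ hw _ hv) (h _ hy _ hx) (h _ hy _ hv) c1 c2 c3
end

section
/- Let k, l, p, q be positive integers with k ≤ p and l ≤ q. Let A be a real k×p matrix of rank k whose last column is the standard basis vector with a 1 in the last row and 0 elsewhere, and let B be a real l×q matrix of rank l whose first column is the standard basis vector with a 1 in the first row and 0 elsewhere; assume all maximal minors of A and of B are nonnegative. Let C be the (k+l)×(p+q−1) real matrix whose first p−1 columns are the first p−1 columns of A extended by l zeros below, whose p-th column has entry 1 in rows k and k+1 and 0 elsewhere, and whose last q−1 columns are the last q−1 columns of B extended by k zeros above. Then all maximal minors of C are nonnegative. -/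
/-- All maximal minors of the `m × n` real matrix `A` are nonnegative: for every strictly
increasing `f : Fin m → Fin n`, the determinant of the `m × m` submatrix of `A` with
columns `f 0, …, f (m-1)` is nonnegative. -/
def NonnegMaxMinors {m n : ℕ} (A : Matrix (Fin m) (Fin n) ℝ) : Prop :=
  ∀ f : Fin m → Fin n, StrictMono f → 0 ≤ (A.submatrix id f).det

/-- The matrix realizing the series connection: `C` is the `(k+l) × (p+q−1)` matrix (here
`p = p'+1` and `q = q'+1`) whose first `p−1` columns are the first `p−1` columns of `A`
extended by zeros below, whose `p`-th column has entry `1` in rows `k` and `k+1` and `0`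
elsewhere, and whose last `q−1` columns are the last `q−1` columns of `B` extended by
zeros above. -/
noncomputable def seriesMatrix {k l p' q' : ℕ}
    (A : Matrix (Fin k) (Fin (p' + 1)) ℝ) (B : Matrix (Fin l) (Fin (q' + 1)) ℝ) :
    Matrix (Fin (k + l)) (Fin (p' + 1 + q')) ℝ :=
  Matrix.of fun i j =>
    if hj : (j : ℕ) < p' then
      (if hi : (i : ℕ) < k then A ⟨i, hi⟩ ⟨j, by omega⟩ else 0)
    else if (j : ℕ) = p' then
      (if (i : ℕ) = k - 1 ∨ (i : ℕ) = k then (1 : ℝ) else 0)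
    else if hi : k ≤ (i : ℕ) then
      B ⟨(i : ℕ) - k, by have := i.isLt; omega⟩ ⟨(j : ℕ) - p', by have := j.isLt; omega⟩
    else 0

/-- Block-diagonal sum. -/
noncomputable def dsum {k l P Q : ℕ} (A : Matrix (Fin k) (Fin P) ℝ) (B : Matrix (Fin l) (Fin Q) ℝ) :
    Matrix (Fin (k + l)) (Fin (P + Q)) ℝ :=
  Matrix.of fun i j =>
    if hi : (i : ℕ) < k then
      (if hj : (j : ℕ) < P then A ⟨i, hi⟩ ⟨j, hj⟩ else 0)
    else
      (if hj : (j : ℕ) < P then 0 else B ⟨i - k, by omega⟩ ⟨j - P, by omega⟩)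

/-- A square matrix with a zero block that is too large has zero determinant. -/
theorem det_zero_of_block {n : ℕ} (M : Matrix (Fin n) (Fin n) ℝ) (R S : Finset (Fin n))
    (h : R.card < S.card) (hM : ∀ i j, i ∉ R → j ∈ S → M i j = 0) : M.det = 0 := by
  rw [Matrix.det_apply]
  apply Finset.sum_eq_zero
  intro σ _
  have : ∃ j ∈ S, σ j ∉ R := by
    by_contra hc
    push Not at hc
    have := Finset.card_le_card_of_injOn σ hc σ.injective.injOn
    omega
  obtain ⟨j, hj, hj'⟩ := this
  have h0 : ∏ i, M (σ i) i = 0 :=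
    Finset.prod_eq_zero (f := fun i => M (σ i) i) (Finset.mem_univ j) (hM _ _ hj' hj)
  rw [h0, smul_zero]

theorem dsum_nonneg {k l P Q : ℕ} (A : Matrix (Fin k) (Fin P) ℝ) (B : Matrix (Fin l) (Fin Q) ℝ)
    (hA : NonnegMaxMinors A) (hB : NonnegMaxMinors B) : NonnegMaxMinors (dsum A B) := by
  intro f hf
  by_cases h1 : ∃ i : Fin (k + l), (i : ℕ) < k ∧ P ≤ (f i : ℕ)
  · obtain ⟨i, hi, hfi⟩ := h1
    refine le_of_eq (Eq.symm (det_zero_of_block _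
      ((Finset.univ : Finset (Fin l)).image (Fin.natAdd k)) (Finset.Ici i) ?_ ?_))
    · refine lt_of_le_of_lt Finset.card_image_le ?_
      simp
      omega
    · intro r c hr hc
      have hc' : f i ≤ f c := hf.monotone (Finset.mem_Ici.1 hc)
      have hc'' : (f i : ℕ) ≤ f c := hc'
      have hr' : (r : ℕ) < k := by
        by_contra hcon
        apply hr
        refine Finset.mem_image.2 ⟨⟨r - k, by omega⟩, Finset.mem_univ _, ?_⟩
        ext; simp; omega
      simp only [Matrix.submatrix_apply, dsum, Matrix.of_apply, id]
      rw [dif_pos hr', dif_neg (by omega)]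
  by_cases h2 : ∃ i : Fin (k + l), k ≤ (i : ℕ) ∧ (f i : ℕ) < P
  · obtain ⟨i, hi, hfi⟩ := h2
    refine le_of_eq (Eq.symm (det_zero_of_block _
      ((Finset.univ : Finset (Fin k)).image (Fin.castAdd l)) (Finset.Iic i) ?_ ?_))
    · refine lt_of_le_of_lt Finset.card_image_le ?_
      simp
      omega
    · intro r c hr hc
      have hc' : f c ≤ f i := hf.monotone (Finset.mem_Iic.1 hc)
      have hc'' : (f c : ℕ) ≤ f i := hc'
      have hr' : ¬ (r : ℕ) < k := by
        intro hcon
        apply hr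
        exact Finset.mem_image.2 ⟨⟨r, hcon⟩, Finset.mem_univ _, by ext; simp⟩
      simp only [Matrix.submatrix_apply, dsum, Matrix.of_apply, id]
      rw [dif_neg hr', dif_pos (by omega)]
  push Not at h1 h2
  let fA : Fin k → Fin P := fun i => ⟨f (Fin.castAdd l i), h1 _ (by simp)⟩
  let fB : Fin l → Fin Q := fun i => ⟨f (Fin.natAdd k i) - P, by
    have := h2 (Fin.natAdd k i) (by simp)
    have := (f (Fin.natAdd k i)).isLt
    omega⟩
  have hfA : StrictMono fA := by
    intro i j hij
    have : f (Fin.castAdd l i) < f (Fin.castAdd l j) := by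
      apply hf
      exact hij
    exact this
  have hfB : StrictMono fB := by
    intro i j hij
    have h : f (Fin.natAdd k i) < f (Fin.natAdd k j) := by
      apply hf
      have h3 : (i : ℕ) < j := hij
      rw [Fin.lt_def, Fin.val_natAdd, Fin.val_natAdd]
      omega
    have h' : (f (Fin.natAdd k i) : ℕ) < f (Fin.natAdd k j) := h
    have := h2 (Fin.natAdd k i) (by simp)
    simp only [fB, Fin.lt_def]
    omega
  have key : ((dsum A B).submatrix id f).submatrix finSumFinEquiv finSumFinEquiv =
      Matrix.fromBlocks (A.submatrix id fA) 0 0 (B.submatrix id fB) := by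
    ext i j
    rcases i with i | i <;> rcases j with j | j
    · have := h1 (Fin.castAdd l j) (by simp)
      simp [dsum, fA, this]
    · have := h2 (Fin.natAdd k j) (by simp)
      simp [dsum, this]
    · have := h1 (Fin.castAdd l j) (by simp)
      simp [dsum, this]
    · have := h2 (Fin.natAdd k j) (by simp)
      simp [dsum, fB, not_lt.2 this]
  rw [← Matrix.det_submatrix_equiv_self finSumFinEquiv, key, Matrix.det_fromBlocks_zero₂₁]
  exact mul_nonneg (hA _ hfA) (hB _ hfB)

/-- If `A` (a real `k × p` matrix of rank `k` whose last column is the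
last standard basis vector) and `B` (a real `l × q` matrix of rank `l` whose first column
is the first standard basis vector) have all nonnegative maximal minors, then so does the
`(k+l) × (p+q−1)` series-connection matrix `C` built from them (here `p = p'+1`,
`q = q'+1`). -/
theorem seriesMatrix_nonneg_maximal_minors (k l p' q' : ℕ) (hk : 0 < k) (hl : 0 < l)
    (hkp : k ≤ p' + 1) (hlq : l ≤ q' + 1)
    (A : Matrix (Fin k) (Fin (p' + 1)) ℝ) (B : Matrix (Fin l) (Fin (q' + 1)) ℝ)
    (hArank : A.rank = k) (hBrank : B.rank = l)
    (hAcol : ∀ i : Fin k, A i (Fin.last p') = if (i : ℕ) = k - 1 then 1 else 0)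
    (hBcol : ∀ i : Fin l, B i ⟨0, Nat.succ_pos q'⟩ = if (i : ℕ) = 0 then 1 else 0)
    (hA : NonnegMaxMinors A) (hB : NonnegMaxMinors B) :
    NonnegMaxMinors (seriesMatrix A B) := by
  intro f hf
  let g1 : Fin (p' + 1 + q') → Fin (p' + 1 + (q' + 1)) := fun v =>
    ⟨if (v : ℕ) ≤ p' then v else v + 1, by split_ifs <;> omega⟩
  let g2 : Fin (p' + 1 + q') → Fin (p' + 1 + (q' + 1)) := fun v =>
    ⟨if (v : ℕ) < p' then v else v + 1, by split_ifs <;> omega⟩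
  have hg1 : StrictMono g1 := by
    intro a b hab
    have : (a : ℕ) < b := hab
    simp only [g1, Fin.lt_def]
    split_ifs <;> omega
  have hg2 : StrictMono g2 := by
    intro a b hab
    have : (a : ℕ) < b := hab
    simp only [g2, Fin.lt_def]
    split_ifs <;> omega
  have hD := dsum_nonneg A B hA hB
  have n1 := hD _ (hg1.comp hf)
  have n2 := hD _ (hg2.comp hf)
  have c1 : ∀ (i : Fin (k + l)) (v : Fin (p' + 1 + q')), (v : ℕ) ≠ p' → seriesMatrix A B i v = dsum A B i (g1 v) := by
    intro i v hv
    simp only [seriesMatrix, dsum, Matrix.of_apply, g1]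
    rcases lt_or_gt_of_ne hv with h | h
    · have h' : (v : ℕ) < p' + 1 := by omega
      simp [h, h.le, h']
    · by_cases hi : (i : ℕ) < k
      · simp [hi, hv, not_lt.2 h.le, not_le.2 h, not_lt.2 h.le]
      · have e : (v : ℕ) + 1 - (p' + 1) = v - p' := by omega
        simp [hi, hv, not_lt.2 h.le, not_le.2 h, not_lt.1 hi, e]
  have c2 : ∀ (i : Fin (k + l)) (v : Fin (p' + 1 + q')), (v : ℕ) ≠ p' → g2 v = g1 v := by
    intro i v hv
    simp only [g1, g2, Fin.mk.injEq]
    split_ifs <;> omega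
  have c3 : ∀ (i : Fin (k + l)) (v : Fin (p' + 1 + q')), (v : ℕ) = p' →
      seriesMatrix A B i v = dsum A B i (g1 v) + dsum A B i (g2 v) := by
    intro i v hv
    by_cases hi : (i : ℕ) < k
    · have := hAcol ⟨i, hi⟩
      simp only [Fin.last] at this
      simp [seriesMatrix, dsum, g1, g2, hv, hi, this, hi.ne]
    · have := hBcol ⟨i - k, by omega⟩
      simp only [Nat.succ_eq_add_one] at this
      have e : ((i : ℕ) = k - 1 ∨ (i : ℕ) = k) ↔ (i : ℕ) - k = 0 := by omega
      simp [seriesMatrix, dsum, g1, g2, hv, hi, e]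
      simpa using this.symm
  by_cases hex : ∃ j, (f j : ℕ) = p'
  · obtain ⟨j0, hj0⟩ := hex
    have hne : ∀ j, j ≠ j0 → (f j : ℕ) ≠ p' := by
      intro j hj h
      exact hj (hf.injective (Fin.ext (h.trans hj0.symm)))
    have e : (seriesMatrix A B).submatrix id f =
        ((dsum A B).submatrix id (g1 ∘ f)).updateCol j0
          ((fun i => dsum A B i (g1 (f j0))) + (fun i => dsum A B i (g2 (f j0)))) := by
      ext i j
      by_cases hj : j = j0
      · subst hj
        simp [c3 i _ hj0]
      · simp [hj, c1 i _ (hne j hj)]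
    have e1 : ((dsum A B).submatrix id (g1 ∘ f)).updateCol j0
        (fun i => dsum A B i (g1 (f j0))) = (dsum A B).submatrix id (g1 ∘ f) := by
      ext i j
      by_cases hj : j = j0
      · subst hj
        simp
      · simp [hj]
    have e2 : ((dsum A B).submatrix id (g1 ∘ f)).updateCol j0
        (fun i => dsum A B i (g2 (f j0))) = (dsum A B).submatrix id (g2 ∘ f) := by
      ext i j
      by_cases hj : j = j0
      · subst hj
        simp
      · simp [hj, c2 i _ (hne j hj)]
    rw [e, Matrix.det_updateCol_add, e1, e2]
    exact add_nonneg n1 n2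
  · push Not at hex
    have e : (seriesMatrix A B).submatrix id f = (dsum A B).submatrix id (g1 ∘ f) := by
      ext i j
      simp [c1 i _ (hex j)]
    rw [e]
    exact n1
end

section
/- Let B be a real m×n matrix of rank m with n ≥ m and columns (c_1, c_2, …, c_n), and suppose B has all nonnegative maximal minors. Then for every i with 1 ≤ i < n, the m×n matrix B′ with columns (c_{i+1}, …, c_n, (−1)^{m−1} c_1, …, (−1)^{m−1} c_i) also has all nonnegative maximal minors. -/
/-- The matrix with columns `(c_{i+1}, …, c_n, (−1)^{m−1} c_1, …, (−1)^{m−1} c_i)`, where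
`c_1, …, c_n` are the columns of `B`. -/
def rotatedMatrix {m n : ℕ} (B : Matrix (Fin m) (Fin n) ℝ) (i : ℕ) (hin : i < n) :
    Matrix (Fin m) (Fin n) ℝ :=
  Matrix.of fun r t =>
    if h : (t : ℕ) + i < n then B r ⟨(t : ℕ) + i, h⟩
    else (-1 : ℝ) ^ (m - 1) * B r ⟨(t : ℕ) + i - n, by have := t.isLt; omega⟩

theorem rotatedMatrix_succ_aux {m n : ℕ} (B : Matrix (Fin m) (Fin n) ℝ) (i : ℕ)
    (hi : i + 1 < n) (hi' : i < n) (h1 : 1 < n) :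
    rotatedMatrix B (i + 1) hi = rotatedMatrix (rotatedMatrix B i hi') 1 h1 := by
  ext r t
  have ht := t.isLt
  by_cases h : (t : ℕ) + 1 < n
  · by_cases h2 : (t : ℕ) + (i + 1) < n
    · have h3 : (t : ℕ) + 1 + i < n := by omega
      simp only [rotatedMatrix, Matrix.of_apply, dif_pos h, dif_pos h2, dif_pos h3]
      congr 2
      omega
    · have h3 : ¬ ((t : ℕ) + 1 + i < n) := by omega
      simp only [rotatedMatrix, Matrix.of_apply, dif_pos h, dif_neg h2, dif_neg h3]
      congr 3
      omega
  · have h2 : ¬ ((t : ℕ) + (i + 1) < n) := by omega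
    have h3 : (t : ℕ) + 1 - n + i < n := by omega
    simp only [rotatedMatrix, Matrix.of_apply, dif_neg h, dif_neg h2, dif_pos h3]
    congr 3
    omega

theorem rotatedMatrix_one_aux {m n : ℕ} (C : Matrix (Fin m) (Fin n) ℝ)
    (hC : NonnegMaxMinors C) (h1 : 1 < n) : NonnegMaxMinors (rotatedMatrix C 1 h1) := by
  intro f hf
  cases m with
  | zero => simp
  | succ k =>
    by_cases hl : (f (Fin.last k) : ℕ) + 1 < n
    · have hj : ∀ j, (f j : ℕ) + 1 < n := fun j => by
        have : f j ≤ f (Fin.last k) := hf.monotone (Fin.le_last j)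
        have : (f j : ℕ) ≤ f (Fin.last k) := this
        omega
      have := hC (fun j => ⟨(f j : ℕ) + 1, hj j⟩) (fun a b hab => by
        have : (f a : ℕ) < f b := hf hab
        simp only [Fin.mk_lt_mk]; omega)
      convert this using 2
      ext r j
      simp [rotatedMatrix, hj j]
    · have hj : ∀ j : Fin k, (f j.castSucc : ℕ) + 1 < n := fun j => by
        have : (f j.castSucc : ℕ) < f (Fin.last k) := hf (Fin.castSucc_lt_last j)
        have := (f (Fin.last k)).isLt
        omega
      let g : Fin (k + 1) → Fin n :=
        Fin.cons ⟨0, by omega⟩ (fun j => ⟨(f j.castSucc : ℕ) + 1, hj j⟩)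
      have hg : StrictMono g := by
        intro a b hab
        induction b using Fin.cases with
        | zero => exact absurd hab (Fin.not_lt_zero a)
        | succ b =>
          induction a using Fin.cases with
          | zero => simp [g]
          | succ a =>
            have hab' : a < b := by simpa using hab
            have : (f a.castSucc : ℕ) < f b.castSucc := hf (by simpa using hab')
            simp only [g, Fin.cons_succ, Fin.mk_lt_mk]; omega
      have h0 := hC g hg
      let v : Fin (k + 1) → ℝ := fun j => if j = Fin.last k then (-1 : ℝ) ^ k else 1
      have hM : (rotatedMatrix C 1 h1).submatrix id f =
          Matrix.of fun r j =>
            v j * ((C.submatrix id g).submatrix id (finRotate (k + 1))) r j := by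
        ext r j
        induction j using Fin.lastCases with
        | last =>
          have hz : (f (Fin.last k) : ℕ) + 1 - n = 0 := by
            have := (f (Fin.last k)).isLt
            omega
          simp [rotatedMatrix, hl, v, g, hz]
        | cast j =>
          have hne : j.castSucc ≠ Fin.last k := (Fin.castSucc_lt_last j).ne
          have hrot : finRotate (k + 1) j.castSucc = j.succ := by
            simp
          simp only [Matrix.submatrix_apply, Matrix.of_apply, hrot, v, if_neg hne, g,
            Fin.cons_succ, rotatedMatrix, dif_pos (hj j), one_mul, id]
      rw [hM, Matrix.det_mul_row, Matrix.det_permute', sign_finRotate]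
      have hv : ∏ j, v j = (-1 : ℝ) ^ k := by simp [v]
      rw [hv, ← mul_assoc, Nat.add_sub_cancel]
      have : (-1 : ℝ) ^ k * (((-1 : ℤˣ) ^ k : ℤˣ) : ℤ) = 1 := by
        push_cast
        rw [← mul_pow]; norm_num
      rw [this, one_mul]
      exact h0

/-- If a real `m × n` matrix `B` of rank `m` (with `m ≤ n`) has all
nonnegative maximal minors, then for every `1 ≤ i < n` the matrix with columns
`(c_{i+1}, …, c_n, (−1)^{m−1} c_1, …, (−1)^{m−1} c_i)` also has all nonnegative maximal
minors. -/
theorem rotatedMatrix_nonneg_maximal_minors (m n : ℕ) (hmn : m ≤ n)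
    (B : Matrix (Fin m) (Fin n) ℝ) (hrank : B.rank = m) (hB : NonnegMaxMinors B)
    (i : ℕ) (hi1 : 1 ≤ i) (hin : i < n) :
    NonnegMaxMinors (rotatedMatrix B i hin) := by
  induction i, hi1 using Nat.le_induction with
  | base => exact rotatedMatrix_one_aux B hB hin
  | succ i hi ih =>
    rw [rotatedMatrix_succ_aux B i hin (by omega) (by omega)]
    exact rotatedMatrix_one_aux _ (ih (by omega)) _
end
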